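/- arXiv:1208.1688 — 8 statements merged into one kernel-verified Lean document; each statement's English description precedes it below -/
import Mathlib

section
/- Let G be a finite simple graph, let S be a vertex cover of G, and let k be a positive integer. Then there exists a vertex cover S' of G with |S'| < |S| and dist(S, S') ≤ k if and only if there exists a set S* ⊆ S such that: (1) S* is an independent set in G, (2) |N(S*) \ S| < |S*|, and (3) |N(S*) \ S| + |S*| ≤ k. -/
variable {V : Type*}

/-- `S` is a vertex cover of `G`: every edge has at least one endpoint in `S`. -/
def IsVertexCover (G : SimpleGraph V) (S : Set V) : Prop :=
  ∀ ⦃u v : V⦄, G.Adj u v → u ∈ S ∨ v ∈ S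

/-- `S` is an independent set of `G`: no edge has both endpoints in `S`. -/
def IsIndepSet (G : SimpleGraph V) (S : Set V) : Prop :=
  ∀ ⦃u : V⦄, u ∈ S → ∀ ⦃v : V⦄, v ∈ S → ¬ G.Adj u v

/-- `nbhd G S = N(S)`: vertices outside `S` adjacent to at least one vertex of `S`. -/
def nbhd (G : SimpleGraph V) (S : Set V) : Set V :=
  {v : V | v ∉ S ∧ ∃ s ∈ S, G.Adj s v}

/-- `dist(S₁,S₂) = |S₁ ∪ S₂| − |S₁ ∩ S₂|` (the size of the symmetric difference). -/
noncomputable def setDist (S₁ S₂ : Set V) : ℕ :=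
  (S₁ ∪ S₂).ncard - (S₁ ∩ S₂).ncard

theorem setDist_eq_ncard_diff_add_ncard_diff [Finite V] (S T : Set V) :
    setDist S T = (T \ S).ncard + (S \ T).ncard := by
  have h₁ := Set.ncard_union_add_ncard_inter S T
  have h₂ := Set.ncard_inter_add_ncard_sdiff_eq_ncard S T
  have h₃ := Set.ncard_inter_add_ncard_sdiff_eq_ncard T S
  rw [Set.inter_comm] at h₃
  unfold setDist
  omega

theorem IsVertexCover.isIndepSet_diff {G : SimpleGraph V} {T : Set V} (hT : IsVertexCover G T)
    (S : Set V) : IsIndepSet G (S \ T) :=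
  fun _ hu _ hv huv => (hT huv).elim hu.2 hv.2

theorem IsVertexCover.nbhd_diff_subset {G : SimpleGraph V} {T : Set V} (hT : IsVertexCover G T)
    (S : Set V) : nbhd G (S \ T) \ S ⊆ T \ S := by
  rintro v ⟨⟨-, s, hs, hsv⟩, hv⟩
  exact ⟨(hT hsv).resolve_left hs.2, hv⟩

/-- Exchanging an independent part of a vertex cover for its outside neighbours yields a
vertex cover. -/
theorem IsVertexCover.exchange {G : SimpleGraph V} {S I : Set V} (hS : IsVertexCover G S)
    (hI : IsIndepSet G I) : IsVertexCover G ((S \ I) ∪ (nbhd G I \ S)) := by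
  have key : ∀ u v, G.Adj u v → u ∈ S →
      u ∈ (S \ I) ∪ (nbhd G I \ S) ∨ v ∈ (S \ I) ∪ (nbhd G I \ S) := by
    intro u v huv hu
    by_cases huI : u ∈ I
    · have hvI : v ∉ I := fun hvI => hI huI hvI huv
      by_cases hv : v ∈ S
      · exact .inr (.inl ⟨hv, hvI⟩)
      · exact .inr (.inr ⟨⟨hvI, u, huI, huv⟩, hv⟩)
    · exact .inl (.inl ⟨hu, huI⟩)
  intro u v huv
  rcases hS huv with hu | hv
  · exact key u v huv hu
  · exact (key v u huv.symm hv).symm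

/-- Lemma 6: `G` has a smaller vertex cover within distance `k` of `S`
iff there is an independent `S* ⊆ S` with `|N(S*) \ S| < |S*|` and `|N(S*) \ S| + |S*| ≤ k`. -/
theorem stmt0 [Fintype V] (G : SimpleGraph V) (S : Set V) (k : ℕ)
    (hS : IsVertexCover G S) (hk : 0 < k) :
    (∃ S' : Set V, IsVertexCover G S' ∧ S'.ncard < S.ncard ∧ setDist S S' ≤ k) ↔
      ∃ Sstar : Set V, Sstar ⊆ S ∧ IsIndepSet G Sstar ∧
        (nbhd G Sstar \ S).ncard < Sstar.ncard ∧
        (nbhd G Sstar \ S).ncard + Sstar.ncard ≤ k := by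
  constructor
  · rintro ⟨T, hT, hlt, hdist⟩
    have hle := Set.ncard_le_ncard (hT.nbhd_diff_subset S)
    have h₂ := Set.ncard_inter_add_ncard_sdiff_eq_ncard S T
    have h₃ := Set.ncard_inter_add_ncard_sdiff_eq_ncard T S
    rw [Set.inter_comm] at h₃
    rw [setDist_eq_ncard_diff_add_ncard_diff] at hdist
    exact ⟨S \ T, Set.sdiff_subset, hT.isIndepSet_diff S, by omega, by omega⟩
  · rintro ⟨I, hIS, hI, hlt, hle⟩
    have hsdiff : S \ ((S \ I) ∪ (nbhd G I \ S)) = I := by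
      ext v
      have := @hIS v
      simp only [Set.mem_sdiff, Set.mem_union]
      tauto
    have hdiff : ((S \ I) ∪ (nbhd G I \ S)) \ S = nbhd G I \ S := by
      ext v
      simp only [Set.mem_sdiff, Set.mem_union]
      tauto
    refine ⟨(S \ I) ∪ (nbhd G I \ S), hS.exchange hI, ?_, ?_⟩
    · have h₁ := Set.ncard_union_le (S \ I) (nbhd G I \ S)
      have h₂ := Set.ncard_sdiff_add_ncard_of_subset hIS
      omega
    · rwa [setDist_eq_ncard_diff_add_ncard_diff, hsdiff, hdiff]
end

section
/- Let G be a finite simple bipartite graph with bipartition (A, B) such that A is a vertex cover of G, and let k be a positive integer. If S ⊆ A satisfies |S| ≤ k and |N(S)| < |S|, then the set C = (A \ S) ∪ N(S) is a vertex cover of G with |C| ≤ |A| − 1 and dist(A, C) ≤ 2k − 1. -/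
variable {V : Type*}

/-- in a bipartite graph with bipartition `(A,B)` where `A` is a vertex cover,
a Hall set `S ⊆ A` of size at most `k` yields the vertex cover `(A \ S) ∪ N(S)` of size
at most `|A| - 1` within distance `2k - 1` of `A`. -/
theorem stmt1 [Fintype V] (G : SimpleGraph V) (A B : Set V) (k : ℕ)
    (hunion : A ∪ B = Set.univ) (hdisj : A ∩ B = ∅)
    (hAi : IsIndepSet G A) (hBi : IsIndepSet G B)
    (hvc : IsVertexCover G A) (hk : 0 < k)
    (S : Set V) (hSA : S ⊆ A) (hSk : S.ncard ≤ k)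
    (hHall : (nbhd G S).ncard < S.ncard) :
    IsVertexCover G ((A \ S) ∪ nbhd G S) ∧
      ((A \ S) ∪ nbhd G S).ncard + 1 ≤ A.ncard ∧
      setDist A ((A \ S) ∪ nbhd G S) ≤ 2 * k - 1 := by
  have hcover : ∀ ⦃u v : V⦄, G.Adj u v → u ∈ A →
      u ∈ (A \ S) ∪ nbhd G S ∨ v ∈ (A \ S) ∪ nbhd G S := by
    intro u v huv hu
    by_cases huS : u ∈ S
    · exact Or.inr (Or.inr ⟨fun hvS => hAi hu (hSA hvS) huv, u, huS, huv⟩)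
    · exact Or.inl (Or.inl ⟨hu, huS⟩)
  have hdiff : (A \ S).ncard + S.ncard = A.ncard :=
    Set.ncard_sdiff_add_ncard_of_subset hSA
  refine ⟨fun u v huv => ?_, ?_, ?_⟩
  · rcases hvc huv with hu | hv
    · exact hcover huv hu
    · exact (hcover huv.symm hv).symm
  · have := Set.ncard_union_le (A \ S) (nbhd G S)
    omega
  · have hunion_eq : A ∪ ((A \ S) ∪ nbhd G S) = A ∪ nbhd G S := by
      rw [← Set.union_assoc, Set.union_eq_self_of_subset_right Set.sdiff_subset]
    have hinter : (A \ S).ncard ≤ (A ∩ ((A \ S) ∪ nbhd G S)).ncard :=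
      Set.ncard_le_ncard fun x hx => ⟨hx.1, Or.inl hx⟩
    have := Set.ncard_union_le A (nbhd G S)
    rw [setDist, hunion_eq]
    omega
end

section
/- Let G = (V, E) be a finite simple graph, let k ≥ 4 be an integer, set t = C(k,2) − k − 1, and let H be the bipartite graph of the Hall-set construction with parts A = {v_e : e ∈ E} and B = V ∪ U, |U| = t. If C ⊆ V is a clique of size k in G, then the set S = {v_e ∈ A : both endpoints of e lie in C} satisfies |S| = C(k,2) and |N_H(S)| = C(k,2) − 1; in particular |N_H(S)| < |S| ≤ C(k,2). -/
variable {V : Type*}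

/-- Vertex set of the Hall-set construction: `A = {vₑ : e ∈ E}` (left summand) and
`B = V ∪ U` with `|U| = t` (right summand). -/
abbrev HallV (G : SimpleGraph V) (t : ℕ) : Type _ := ↥G.edgeSet ⊕ (V ⊕ Fin t)

/-- The bipartite graph of the Hall-set construction: `vₑ` is adjacent to both endpoints
of `e` and to every vertex of `U`; there are no other edges. -/
def hallGraph (G : SimpleGraph V) (t : ℕ) : SimpleGraph (HallV G t) :=
  SimpleGraph.fromRel (fun x y =>
    ∃ e : G.edgeSet, x = Sum.inl e ∧
      ((∃ v : V, y = Sum.inr (Sum.inl v) ∧ v ∈ (e : Sym2 V)) ∨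
       (∃ u : Fin t, y = Sum.inr (Sum.inr u))))

/-- The vertices of the Hall-set construction corresponding to the edges inside `C`. -/
def edgesWithin (G : SimpleGraph V) (t : ℕ) (C : Set V) : Set (HallV G t) :=
  {x | ∃ e : G.edgeSet, x = Sum.inl e ∧ ∀ v ∈ (e : Sym2 V), v ∈ C}

@[simp]
theorem hallGraph_adj_inl_inl (G : SimpleGraph V) (t : ℕ) (e f : G.edgeSet) :
    ¬ (hallGraph G t).Adj (Sum.inl e) (Sum.inl f) := by
  simp [hallGraph]

@[simp]
theorem hallGraph_adj_inl_vertex (G : SimpleGraph V) (t : ℕ) (e : G.edgeSet) (v : V) :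
    (hallGraph G t).Adj (Sum.inl e) (Sum.inr (Sum.inl v)) ↔ v ∈ (e : Sym2 V) := by
  simp [hallGraph]

@[simp]
theorem hallGraph_adj_inl_extra (G : SimpleGraph V) (t : ℕ) (e : G.edgeSet) (u : Fin t) :
    (hallGraph G t).Adj (Sum.inl e) (Sum.inr (Sum.inr u)) := by
  simp [hallGraph]

/-- A finite clique spans `C(|C|, 2)` edges. -/
theorem ncard_edgesWithin (G : SimpleGraph V) (t : ℕ) {C : Set V} (hC : G.IsClique C)
    (hfin : C.Finite) : (edgesWithin G t C).ncard = C.ncard.choose 2 := by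
  classical
  have himage : edgesWithin G t C =
      (Sum.inl : G.edgeSet → HallV G t) '' {e | ∀ v ∈ (e : Sym2 V), v ∈ C} := by
    ext x
    simp only [edgesWithin, Set.mem_ofPred_eq, Set.mem_image]
    exact ⟨fun ⟨e, hx, he⟩ => ⟨e, he, hx.symm⟩, fun ⟨e, he, hx⟩ => ⟨e, hx.symm, he⟩⟩
  have hcoe : ((↑) : G.edgeSet → Sym2 V) '' {e | ∀ v ∈ (e : Sym2 V), v ∈ C} =
      (hfin.toFinset.offDiag.image Sym2.mk.uncurry : Finset (Sym2 V)) := by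
    ext e
    induction e with | _ a b => ?_
    simp only [Set.mem_image, Set.mem_ofPred_eq, Subtype.exists, exists_and_left, exists_prop,
      exists_eq_right_right, Finset.coe_image, Finset.mem_coe, Finset.mem_offDiag,
      Set.Finite.mem_toFinset, Prod.exists, Function.uncurry_apply_pair]
    constructor
    · rintro ⟨h, hab⟩
      exact ⟨a, b, ⟨h a (by simp), h b (by simp), G.ne_of_adj hab⟩, rfl⟩
    · rintro ⟨x, y, ⟨hx, hy, hxy⟩, h⟩
      rw [← h]
      refine ⟨fun v hv => ?_, hC hx hy hxy⟩
      rcases Sym2.mem_iff.1 hv with rfl | rfl <;> assumption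
  rw [himage, Set.ncard_image_of_injective _ Sum.inl_injective,
    ← Set.ncard_image_of_injective _ Subtype.val_injective, hcoe, Set.ncard_coe_finset,
    Sym2.card_image_offDiag, ← Set.ncard_eq_toFinset_card C hfin]

/-- The neighbourhood of the edges of a nontrivial clique consists of the clique and all of `U`. -/
theorem nbhd_edgesWithin (G : SimpleGraph V) (t : ℕ) {C : Set V} (hC : G.IsClique C)
    (hnt : C.Nontrivial) :
    nbhd (hallGraph G t) (edgesWithin G t C) =
      Sum.inr '' (Sum.inl '' C ∪ Set.range (Sum.inr : Fin t → V ⊕ Fin t)) := by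
  have hedge {a b : V} (ha : a ∈ C) (hb : b ∈ C) (hab : a ≠ b) :
      (Sum.inl ⟨s(a, b), hC ha hb hab⟩ : HallV G t) ∈ edgesWithin G t C := by
    refine ⟨_, rfl, fun v hv => ?_⟩
    rcases Sym2.mem_iff.1 hv with rfl | rfl <;> assumption
  ext x
  constructor
  · rintro ⟨-, s, ⟨e, rfl, he⟩, hadj⟩
    rcases x with f | v | u
    · exact absurd hadj (hallGraph_adj_inl_inl G t e f)
    · simpa using he v ((hallGraph_adj_inl_vertex G t e v).1 hadj)
    · simp
  · rintro ⟨_, ⟨v, hv, rfl⟩ | ⟨u, rfl⟩, rfl⟩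
    · obtain ⟨w, hw, hwv⟩ := hnt.exists_ne v
      exact ⟨by simp [edgesWithin], _, hedge hv hw hwv.symm, by simp⟩
    · obtain ⟨a, ha, b, hb, hab⟩ := hnt
      exact ⟨by simp [edgesWithin], _, hedge ha hb hab, by simp⟩

theorem ncard_nbhd_edgesWithin (G : SimpleGraph V) (t : ℕ) {C : Set V} (hC : G.IsClique C)
    (hfin : C.Finite) (hnt : C.Nontrivial) :
    (nbhd (hallGraph G t) (edgesWithin G t C)).ncard = C.ncard + t := by
  rw [nbhd_edgesWithin G t hC hnt, Set.ncard_image_of_injective _ Sum.inr_injective,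
    Set.ncard_union_eq _ (hfin.image _) (Set.finite_range _),
    Set.ncard_image_of_injective _ Sum.inl_injective, ← Set.image_univ,
    Set.ncard_image_of_injective _ Sum.inr_injective, Set.ncard_univ, Nat.card_eq_fintype_card,
    Fintype.card_fin]
  rw [Set.disjoint_left]
  rintro _ ⟨v, -, rfl⟩ ⟨u, hu⟩
  simp at hu

theorem succ_le_choose_two {k : ℕ} (hk : 4 ≤ k) : k + 1 ≤ k.choose 2 := by
  induction k, hk using Nat.le_induction with
  | base => decide
  | succ n hn ih =>
    rw [Nat.choose_succ_succ n 1, Nat.choose_one_right]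
    exact (add_le_add (by omega : 1 ≤ n) ih).trans' (by omega)

/-- a clique `C` of size `k` in `G` yields, in the Hall-set construction `H`,
the set `S = {vₑ : e ⊆ C}` with `|S| = C(k,2)` and `|N_H(S)| = C(k,2) - 1`;
in particular `|N_H(S)| < |S| ≤ C(k,2)`. -/
theorem stmt3 [Fintype V] (G : SimpleGraph V) (k t : ℕ) (hk : 4 ≤ k)
    (ht : t = k.choose 2 - k - 1)
    (C : Set V) (hC : G.IsClique C) (hCk : C.ncard = k)
    (S : Set (HallV G t))
    (hS : S = {x : HallV G t |
      ∃ e : G.edgeSet, x = Sum.inl e ∧ ∀ v ∈ (e : Sym2 V), v ∈ C}) :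
    S.ncard = k.choose 2 ∧
      (nbhd (hallGraph G t) S).ncard = k.choose 2 - 1 ∧
      (nbhd (hallGraph G t) S).ncard < S.ncard ∧ S.ncard ≤ k.choose 2 := by
  have hchoose := succ_le_choose_two hk
  have hfin : C.Finite := C.toFinite
  have hnt : C.Nontrivial := Set.one_lt_ncard_iff_nontrivial.1 (by omega)
  change S = edgesWithin G t C at hS
  have hS_card := ncard_edgesWithin G t hC hfin
  have hN_card := ncard_nbhd_edgesWithin G t hC hfin hnt
  rw [← hS, hCk] at hS_card hN_card
  omega
end

section
/- In the Hall-set construction H for a finite simple graph G = (V, E) and integer k ≥ 4, for every nonempty set S ⊆ A it holds that |S| ≤ C(|V ∩ N_H(S)|, 2). -/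
variable {V : Type*}

theorem Finset.card_le_choose_two_of_sym2 {α : Type*} (E : Finset (Sym2 α)) (W : Finset α)
    (hE : ∀ e ∈ E, ¬ e.IsDiag) (hW : ∀ e ∈ E, ∀ v ∈ e, v ∈ W) :
    E.card ≤ W.card.choose 2 := by
  classical
  rw [← Finset.card_powersetCard]
  refine Finset.card_le_card_of_injOn Sym2.toFinset (fun e he => ?_) (fun e _ f _ hef => ?_)
  · simp only [Finset.mem_coe, Finset.mem_powersetCard]
    exact ⟨fun v hv => hW e he v (Sym2.mem_toFinset.1 hv),
      Sym2.card_toFinset_of_not_isDiag e (hE e he)⟩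
  · refine Sym2.ext fun v => ?_
    simp only [← Sym2.mem_toFinset, hef]

theorem hallGraph_adj_inl_inr_inl {G : SimpleGraph V} {t : ℕ} {e : G.edgeSet} {v : V}
    (hv : v ∈ (e : Sym2 V)) : (hallGraph G t).Adj (Sum.inl e) (Sum.inr (Sum.inl v)) := by
  rw [hallGraph, SimpleGraph.fromRel_adj]
  exact ⟨Sum.inl_ne_inr, Or.inl ⟨e, rfl, Or.inl ⟨v, rfl, hv⟩⟩⟩

/-- in the Hall-set construction `H`, every nonempty `S ⊆ A` satisfies
`|S| ≤ C(|V ∩ N_H(S)|, 2)`. -/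
theorem stmt5 [Fintype V] (G : SimpleGraph V) (k t : ℕ) (hk : 4 ≤ k)
    (ht : t = k.choose 2 - k - 1)
    (S : Set (HallV G t)) (hne : S.Nonempty)
    (hSA : ∀ x ∈ S, ∃ e : G.edgeSet, x = Sum.inl e) :
    S.ncard ≤ ({v : V | Sum.inr (Sum.inl v) ∈ nbhd (hallGraph G t) S}).ncard.choose 2 := by
  classical
  set W := {v : V | Sum.inr (Sum.inl v) ∈ nbhd (hallGraph G t) S}
  let E : Set (Sym2 V) := Subtype.val '' ((Sum.inl : G.edgeSet → HallV G t) ⁻¹' S)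
  have hcard : S.ncard = E.ncard := by
    have hS : Sum.inl '' ((Sum.inl : G.edgeSet → HallV G t) ⁻¹' S) = S :=
      Set.image_preimage_eq_of_subset fun x hx =>
        let ⟨e, he⟩ := hSA x hx
        ⟨e, he.symm⟩
    conv_lhs => rw [← hS]
    rw [Set.ncard_image_of_injective _ Subtype.val_injective,
      Set.ncard_image_of_injective _ Sum.inl_injective]
  rw [hcard, Set.ncard_eq_toFinset_card', Set.ncard_eq_toFinset_card']
  refine Finset.card_le_choose_two_of_sym2 _ _ (fun e he => ?_) (fun e he v hv => ?_)
  · obtain ⟨e, -, rfl⟩ := Set.mem_toFinset.1 he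
    exact G.not_isDiag_of_mem_edgeSet e.2
  · obtain ⟨e, heS, rfl⟩ := Set.mem_toFinset.1 he
    refine Set.mem_toFinset.2 ⟨fun h => ?_, Sum.inl e, heS, hallGraph_adj_inl_inr_inl hv⟩
    obtain ⟨f, hf⟩ := hSA _ h
    exact Sum.inr_ne_inl hf
end

section
/- Let G = (V, E) be a finite simple graph, let k ≥ 4 be an integer, set t = C(k,2) − k − 1 and k' = (3 + t)·C(k,2), let H be the bipartite Hall-set construction for (G, k), and let G' be the 2-subdivision of H with bipartition (A', B') where A ⊆ A' and B ⊆ B'. If S ⊆ A' is a set with |S| ≤ k' and |N_{G'}(S)| < |S|, then G has a clique of size k. -/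
variable {V : Type*}

/-- Vertex set of the 2-subdivision: the original vertices plus, for each edge `xy`,
the two new vertices `z_{xy}` and `z'_{xy}`, encoded as the darts `(x,y)` and `(y,x)`. -/
abbrev SubdivV (G : SimpleGraph V) : Type _ := V ⊕ {p : V × V // G.Adj p.1 p.2}

/-- The 2-subdivision of `G`: each edge `xy` is replaced by the path
`x — z_{xy} — z'_{xy} — y`, where `z_{xy}` is the dart `(x,y)` and `z'_{xy}` the dart
`(y,x)`; a dart is adjacent to its first coordinate and to the reverse dart. -/
def subdiv2 (G : SimpleGraph V) : SimpleGraph (SubdivV G) :=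
  SimpleGraph.fromRel (fun x y =>
    (∃ d : {p : V × V // G.Adj p.1 p.2}, x = Sum.inl d.val.1 ∧ y = Sum.inr d) ∨
    (∃ d d' : {p : V × V // G.Adj p.1 p.2},
      x = Sum.inr d ∧ y = Sum.inr d' ∧ d.val.1 = d'.val.2 ∧ d.val.2 = d'.val.1))

/-- `N²(S)`: the set of vertices at distance exactly 2 from some vertex of `S`. -/
def nbhd2 (G : SimpleGraph V) (S : Set V) : Set V :=
  {w : V | ∃ s ∈ S, G.dist s w = 2}

/-- The part `A' = A ∪ {z'_{ab} : ab ∈ E(H)}` of the bipartition of the 2-subdivision of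
the Hall-set construction graph (`z'_{ab}`, the subdivision vertex adjacent to `b ∈ B`,
is the dart whose first coordinate lies in `B`). -/
def hallA' (G : SimpleGraph V) (t : ℕ) : Set (SubdivV (hallGraph G t)) :=
  {x | (∃ e : G.edgeSet, x = Sum.inl (Sum.inl e)) ∨
       (∃ d : {p : HallV G t × HallV G t // (hallGraph G t).Adj p.1 p.2},
          x = Sum.inr d ∧ ∃ w : V ⊕ Fin t, d.val.1 = Sum.inr w)}

theorem choose_two_add_lt {n k : ℕ} (hk : 4 ≤ k) (hnk : n < k) :
    n.choose 2 + k < n + k.choose 2 := by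
  induction k, hk using Nat.le_induction with
  | base => interval_cases n <;> decide
  | succ k hk ih =>
    have hsucc : (k + 1).choose 2 = k + k.choose 2 := by
      rw [Nat.choose_succ_succ' k 1, Nat.choose_one_right]
    rcases Nat.lt_succ_iff_lt_or_eq.mp hnk with h | rfl
    · have := ih h
      omega
    · omega

theorem isClique_and_card_eq_of_dense (G : SimpleGraph V) {k : ℕ} (hk : 4 ≤ k)
    (F : Finset (Sym2 V)) (W : Finset V) (hFG : ∀ e ∈ F, e ∈ G.edgeSet)
    (hFW : ∀ e ∈ F, ∀ v ∈ e, v ∈ W) (hF : F.card ≤ k.choose 2)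
    (hdense : W.card + k.choose 2 ≤ F.card + k) :
    G.IsClique (W : Set V) ∧ W.card = k := by
  classical
  have hsub : F ⊆ W.offDiag.image Sym2.mk.uncurry := by
    intro e he
    induction e with
    | _ u v =>
      refine Finset.mem_image.mpr ⟨(u, v), Finset.mem_offDiag.mpr ⟨?_, ?_, ?_⟩, rfl⟩
      · exact hFW _ he u (Sym2.mem_mk_left u v)
      · exact hFW _ he v (Sym2.mem_mk_right u v)
      · exact (G.mem_edgeSet.mp (hFG _ he)).ne
  have hcard := Finset.card_le_card hsub
  have himage : (W.offDiag.image Sym2.mk.uncurry).card = W.card.choose 2 :=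
    Sym2.card_image_offDiag W
  have hWk : W.card = k := by
    by_contra hne
    have := choose_two_add_lt hk (n := W.card) (by omega)
    omega
  refine ⟨fun u hu v hv huv => ?_, hWk⟩
  have heq := Finset.eq_of_subset_of_card_le hsub (by rw [himage, hWk]; omega)
  have hmem : s(u, v) ∈ F := by
    rw [heq]
    exact Finset.mem_image.mpr ⟨(u, v), Finset.mem_offDiag.mpr ⟨hu, hv, huv⟩, rfl⟩
  exact G.mem_edgeSet.mp (hFG _ hmem)

/-- Enumeration of the `t + 2` neighbours of `vₑ` in the Hall-set construction. -/
noncomputable def hallNbr (G : SimpleGraph V) (t : ℕ) (e : G.edgeSet) :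
    Bool ⊕ Fin t → V ⊕ Fin t
  | Sum.inl true => Sum.inl (Quot.out (e : Sym2 V)).1
  | Sum.inl false => Sum.inl (Quot.out (e : Sym2 V)).2
  | Sum.inr u => Sum.inr u

theorem mk_out_edge (G : SimpleGraph V) (e : G.edgeSet) :
    s((Quot.out (e : Sym2 V)).1, (Quot.out (e : Sym2 V)).2) = e :=
  Quot.out_eq (e : Sym2 V)

theorem hallNbr_injective (G : SimpleGraph V) (t : ℕ) (e : G.edgeSet) :
    Function.Injective (hallNbr G t e) := by
  have hne : (Quot.out (e : Sym2 V)).1 ≠ (Quot.out (e : Sym2 V)).2 := by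
    have h := e.2
    rw [← mk_out_edge G e] at h
    exact (G.mem_edgeSet.mp h).ne
  rintro ((_ | _) | i) ((_ | _) | j) h <;> simp_all [hallNbr]

theorem hallGraph_adj_hallNbr (G : SimpleGraph V) (t : ℕ) (e : G.edgeSet) (i : Bool ⊕ Fin t) :
    (hallGraph G t).Adj (Sum.inl e) (Sum.inr (hallNbr G t e i)) := by
  refine (SimpleGraph.fromRel_adj _ _ _).mpr ⟨by simp, Or.inl ⟨e, rfl, ?_⟩⟩
  rcases i with (_ | _) | u
  · refine Or.inl ⟨_, rfl, ?_⟩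
    exact Sym2.out_snd_mem _
  · refine Or.inl ⟨_, rfl, ?_⟩
    exact Sym2.out_fst_mem _
  · exact Or.inr ⟨u, rfl⟩

/-- The vertex `z_{ab}` for `a = vₑ` and `b` the `i`-th neighbour of `a`. -/
noncomputable def hallDart (G : SimpleGraph V) (t : ℕ) (e : G.edgeSet) (i : Bool ⊕ Fin t) :
    {p : HallV G t × HallV G t // (hallGraph G t).Adj p.1 p.2} :=
  ⟨(Sum.inl e, Sum.inr (hallNbr G t e i)), hallGraph_adj_hallNbr G t e i⟩

/-- The involution exchanging `z_{xy}` and `z'_{xy}`. -/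
def revDart (H : SimpleGraph V) (d : {p : V × V // H.Adj p.1 p.2}) :
    {p : V × V // H.Adj p.1 p.2} :=
  ⟨(d.1.2, d.1.1), d.2.symm⟩

theorem subdiv2_adj_inl (H : SimpleGraph V) (d : {p : V × V // H.Adj p.1 p.2}) :
    (subdiv2 H).Adj (Sum.inl d.1.1) (Sum.inr d) :=
  (SimpleGraph.fromRel_adj _ _ _).mpr ⟨by simp, Or.inl (Or.inl ⟨d, rfl, rfl⟩)⟩

theorem subdiv2_adj_revDart (H : SimpleGraph V) (d : {p : V × V // H.Adj p.1 p.2}) :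
    (subdiv2 H).Adj (Sum.inr d) (Sum.inr (revDart H d)) := by
  refine (SimpleGraph.fromRel_adj _ _ _).mpr
    ⟨fun h => ?_, Or.inl (Or.inr ⟨d, revDart H d, rfl, rfl, rfl, rfl⟩)⟩
  have h' := congrArg (fun x => x.1.1) (Sum.inr.inj h)
  exact d.2.ne h'

theorem inl_inr_notMem_hallA' (G : SimpleGraph V) (t : ℕ) (w : V ⊕ Fin t) :
    (Sum.inl (Sum.inr w) : SubdivV (hallGraph G t)) ∉ hallA' G t := by
  simp [hallA']

theorem notMem_hallA'_of_fst_eq_inl (G : SimpleGraph V) (t : ℕ)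
    (d : {p : HallV G t × HallV G t // (hallGraph G t).Adj p.1 p.2}) (e : G.edgeSet)
    (hd : d.1.1 = Sum.inl e) :
    (Sum.inr d : SubdivV (hallGraph G t)) ∉ hallA' G t := by
  rintro (⟨e', h⟩ | ⟨d', h, w, hw⟩)
  · exact Sum.inr_ne_inl h
  · rw [← Sum.inr.inj h, hd] at hw
    exact Sum.inl_ne_inr hw

theorem exists_snd_eq_inl_of_fst_eq_inr (G : SimpleGraph V) (t : ℕ) {x y : HallV G t}
    (h : (hallGraph G t).Adj x y) {w : V ⊕ Fin t} (hx : x = Sum.inr w) :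
    ∃ e : G.edgeSet, y = Sum.inl e := by
  obtain ⟨-, ⟨e, he, -⟩ | ⟨e, he, -⟩⟩ := (SimpleGraph.fromRel_adj _ _ _).mp h
  · simp [hx] at he
  · exact ⟨e, he⟩

/-- The edges `e` such that `vₑ` and all vertices `z'` on the paths leaving `vₑ` lie in `S`. -/
def saturatedEdges (G : SimpleGraph V) (t : ℕ) (S : Set (SubdivV (hallGraph G t))) :
    Set G.edgeSet :=
  {e | Sum.inl (Sum.inl e) ∈ S ∧ ∀ i, Sum.inr (revDart _ (hallDart G t e i)) ∈ S}

theorem ncard_saturatedEdges_mul_le [Finite V] (G : SimpleGraph V) (t : ℕ)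
    (S : Set (SubdivV (hallGraph G t))) :
    (saturatedEdges G t S).ncard * (3 + t) ≤ S.ncard := by
  let f : saturatedEdges G t S × Option (Bool ⊕ Fin t) → S
    | (e, none) => ⟨_, e.2.1⟩
    | (e, some i) => ⟨_, e.2.2 i⟩
  have hf : Function.Injective f := by
    rintro ⟨⟨e, he⟩, _ | i⟩ ⟨⟨e', he'⟩, _ | j⟩ h
    · have h1 := Sum.inl.inj (Sum.inl.inj (Subtype.ext_iff.mp h))
      subst h1
      rfl
    · exact (Sum.inl_ne_inr (Subtype.ext_iff.mp h)).elim
    · exact (Sum.inr_ne_inl (Subtype.ext_iff.mp h)).elim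
    · have h0 := Sum.inr.inj (Subtype.ext_iff.mp h)
      have h1 : e = e' := Sum.inl.inj (congrArg (fun x => x.1.2) h0)
      subst h1
      have h2 := Sum.inr.inj (congrArg (fun x => x.1.1) h0)
      rw [hallNbr_injective G t e h2]
  have := Nat.card_le_card_of_injective f hf
  rw [Nat.card_prod, Nat.card_coe_set_eq, Nat.card_coe_set_eq] at this
  simpa [Nat.card_eq_fintype_card, show 3 + t = 2 + t + 1 by omega] using this

/-- Sends `z'` to `z`, and `vₑ` to some `z` next to it whose partner `z'` is not in `S`. -/
noncomputable def hallShift (G : SimpleGraph V) (t : ℕ) (S : Set (SubdivV (hallGraph G t))) :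
    SubdivV (hallGraph G t) → SubdivV (hallGraph G t)
  | Sum.inl (Sum.inl e) =>
    open Classical in
    if h : ∃ i, Sum.inr (revDart _ (hallDart G t e i)) ∉ S then
      Sum.inr (hallDart G t e h.choose)
    else Sum.inl (Sum.inl e)
  | Sum.inl (Sum.inr w) => Sum.inl (Sum.inr w)
  | Sum.inr d => Sum.inr (revDart _ d)

theorem hallShift_inl_inl (G : SimpleGraph V) (t : ℕ) (S : Set (SubdivV (hallGraph G t)))
    (e : G.edgeSet) (heS : Sum.inl (Sum.inl e) ∈ S) (he : e ∉ saturatedEdges G t S) :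
    ∃ i, Sum.inr (revDart _ (hallDart G t e i)) ∉ S ∧
      hallShift G t S (Sum.inl (Sum.inl e)) = Sum.inr (hallDart G t e i) := by
  have h : ∃ i, Sum.inr (revDart _ (hallDart G t e i)) ∉ S := by
    by_contra! h
    exact he ⟨heS, h⟩
  exact ⟨h.choose, h.choose_spec, dif_pos h⟩

theorem hallShift_injOn (G : SimpleGraph V) (t : ℕ) (S : Set (SubdivV (hallGraph G t)))
    (hS : S ⊆ hallA' G t) :
    Set.InjOn (hallShift G t S)
      (S \ (fun e => Sum.inl (Sum.inl e)) '' saturatedEdges G t S) := by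
  have hsat : ∀ {e : G.edgeSet}, (Sum.inl (Sum.inl e) : SubdivV (hallGraph G t)) ∉
      (fun e => Sum.inl (Sum.inl e)) '' saturatedEdges G t S → e ∉ saturatedEdges G t S :=
    fun h he => h ⟨_, he, rfl⟩
  rintro ((e | w) | d) ⟨hx, hx'⟩ ((e' | w') | d') ⟨hy, hy'⟩ h
  · obtain ⟨i, -, hi⟩ := hallShift_inl_inl G t S e hx (hsat hx')
    obtain ⟨j, -, hj⟩ := hallShift_inl_inl G t S e' hy (hsat hy')
    rw [hi, hj] at h
    have h1 : e = e' := Sum.inl.inj (congrArg (fun x => x.1.1) (Sum.inr.inj h))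
    rw [h1]
  · exact (inl_inr_notMem_hallA' G t w' (hS hy)).elim
  · obtain ⟨i, hi', hi⟩ := hallShift_inl_inl G t S e hx (hsat hx')
    rw [hi] at h
    rw [Sum.inr.inj h] at hi'
    exact (hi' hy).elim
  · exact (inl_inr_notMem_hallA' G t w (hS hx)).elim
  · exact (inl_inr_notMem_hallA' G t w (hS hx)).elim
  · exact (inl_inr_notMem_hallA' G t w (hS hx)).elim
  · obtain ⟨i, hi', hi⟩ := hallShift_inl_inl G t S e' hy (hsat hy')
    rw [hi] at h
    rw [← Sum.inr.inj h] at hi'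
    exact (hi' hx).elim
  · exact (inl_inr_notMem_hallA' G t w' (hS hy)).elim
  · have h1 := congrArg (revDart _) (Sum.inr.inj h)
    exact congrArg Sum.inr h1

theorem exists_hallShift_eq_hallDart (G : SimpleGraph V) (t : ℕ)
    (S : Set (SubdivV (hallGraph G t))) (hS : S ⊆ hallA' G t) (x : SubdivV (hallGraph G t))
    (hx : x ∈ S \ (fun e => Sum.inl (Sum.inl e)) '' saturatedEdges G t S) :
    ∃ d, hallShift G t S x = Sum.inr d ∧ Sum.inr d ∈ nbhd (subdiv2 (hallGraph G t)) S := by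
  obtain ⟨hx, hx'⟩ := hx
  rcases x with (e | w) | d
  · obtain ⟨i, -, hi⟩ := hallShift_inl_inl G t S e hx fun he => hx' ⟨_, he, rfl⟩
    exact ⟨_, hi, fun h => notMem_hallA'_of_fst_eq_inl G t _ e rfl (hS h), _, hx,
      subdiv2_adj_inl _ (hallDart G t e i)⟩
  · exact (inl_inr_notMem_hallA' G t w (hS hx)).elim
  · refine ⟨_, rfl, fun h => ?_, _, hx, subdiv2_adj_revDart _ d⟩
    rcases hS hx with ⟨e, he⟩ | ⟨d', hd', w, hw⟩
    · exact Sum.inr_ne_inl he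
    · obtain rfl := Sum.inr.inj hd'
      obtain ⟨e, he⟩ := exists_snd_eq_inl_of_fst_eq_inr G t d.2 hw
      exact notMem_hallA'_of_fst_eq_inl G t _ e he (hS h)

theorem inl_inr_hallNbr_mem_nbhd (G : SimpleGraph V) (t : ℕ)
    (S : Set (SubdivV (hallGraph G t))) (hS : S ⊆ hallA' G t) {e : G.edgeSet}
    (he : e ∈ saturatedEdges G t S) (i : Bool ⊕ Fin t) :
    Sum.inl (Sum.inr (hallNbr G t e i)) ∈ nbhd (subdiv2 (hallGraph G t)) S :=
  ⟨fun h => inl_inr_notMem_hallA' G t _ (hS h), _, he.2 i,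
    (subdiv2_adj_inl _ (revDart _ (hallDart G t e i))).symm⟩

/-- The saturated edges form a Hall violator in the Hall-set construction itself. -/
theorem ncard_neighbors_lt_ncard_saturatedEdges [Finite V] (G : SimpleGraph V) (t : ℕ)
    (S : Set (SubdivV (hallGraph G t))) (hS : S ⊆ hallA' G t)
    (hHall : (nbhd (subdiv2 (hallGraph G t)) S).ncard < S.ncard) :
    (⋃ e ∈ saturatedEdges G t S, Set.range (hallNbr G t e)).ncard <
      (saturatedEdges G t S).ncard := by
  set F := saturatedEdges G t S with hF
  set j : G.edgeSet → SubdivV (hallGraph G t) := fun e => Sum.inl (Sum.inl e) with hj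
  set B : Set (V ⊕ Fin t) := ⋃ e ∈ F, Set.range (hallNbr G t e)
  let b : V ⊕ Fin t → SubdivV (hallGraph G t) := fun w => Sum.inl (Sum.inr w)
  have hjF : (j '' F).ncard = F.ncard :=
    Set.ncard_image_of_injective _ (Sum.inl_injective.comp Sum.inl_injective)
  have hbB : (b '' B).ncard = B.ncard :=
    Set.ncard_image_of_injective _ (Sum.inl_injective.comp Sum.inr_injective)
  have hT : (S \ j '' F).ncard + F.ncard = S.ncard := by
    rw [← hjF]
    refine Set.ncard_sdiff_add_ncard_of_subset ?_
    rintro _ ⟨e, he, rfl⟩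
    exact he.1
  have himage := (hallShift_injOn G t S hS).ncard_image
  rw [← hF, ← hj] at himage
  have hdisj : Disjoint (hallShift G t S '' (S \ j '' F)) (b '' B) := by
    rw [Set.disjoint_left]
    rintro _ ⟨x, hx, rfl⟩ ⟨w, -, hw⟩
    obtain ⟨d, hd, -⟩ := exists_hallShift_eq_hallDart G t S hS x hx
    rw [hd] at hw
    exact Sum.inl_ne_inr hw
  have hsub : hallShift G t S '' (S \ j '' F) ∪ b '' B ⊆
      nbhd (subdiv2 (hallGraph G t)) S := by
    refine Set.union_subset ?_ ?_
    · rintro _ ⟨x, hx, rfl⟩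
      obtain ⟨d, hd, hmem⟩ := exists_hallShift_eq_hallDart G t S hS x hx
      rwa [hd]
    · rintro _ ⟨w, hw, rfl⟩
      obtain ⟨e, he, i, rfl⟩ := Set.mem_iUnion₂.mp hw
      exact inl_inr_hallNbr_mem_nbhd G t S hS he i
  have hle := Set.ncard_le_ncard hsub
  rw [Set.ncard_union_eq hdisj, himage, hbB] at hle
  omega

/-- in the 2-subdivision `G'` of the Hall-set construction, a set `S ⊆ A'`
with `|S| ≤ k' = (3 + t)·C(k,2)` and `|N_{G'}(S)| < |S|` implies that `G` has a clique
of size `k`. -/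
theorem stmt7 [Fintype V] (G : SimpleGraph V) (k t k' : ℕ) (hk : 4 ≤ k)
    (ht : t = k.choose 2 - k - 1) (hk' : k' = (3 + t) * k.choose 2)
    (S : Set (SubdivV (hallGraph G t))) (hSA' : S ⊆ hallA' G t)
    (hcard : S.ncard ≤ k')
    (hHall : (nbhd (subdiv2 (hallGraph G t)) S).ncard < S.ncard) :
    ∃ C : Set V, G.IsClique C ∧ C.ncard = k := by
  classical
  set F := saturatedEdges G t S with hF
  have hlt := ncard_neighbors_lt_ncard_saturatedEdges G t S hSA' hHall
  have hmul := ncard_saturatedEdges_mul_le G t S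
  rw [← hF] at hlt hmul
  set W : Set V := {v | ∃ e ∈ F, v ∈ (e : Sym2 V)} with hW
  obtain ⟨e₀, he₀⟩ : F.Nonempty := Set.nonempty_of_ncard_ne_zero (by omega)
  have hsub : Sum.inl '' W ∪ Set.range (Sum.inr : Fin t → V ⊕ Fin t) ⊆
      ⋃ e ∈ F, Set.range (hallNbr G t e) := by
    refine Set.union_subset ?_ ?_
    · rintro _ ⟨v, ⟨e, he, hv⟩, rfl⟩
      rw [← mk_out_edge G e, Sym2.mem_iff] at hv
      rcases hv with rfl | rfl
      · exact Set.mem_iUnion₂.mpr ⟨e, he, Sum.inl true, rfl⟩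
      · exact Set.mem_iUnion₂.mpr ⟨e, he, Sum.inl false, rfl⟩
    · rintro _ ⟨u, rfl⟩
      exact Set.mem_iUnion₂.mpr ⟨e₀, he₀, Sum.inr u, rfl⟩
  have hdisj : Disjoint (Sum.inl '' W) (Set.range (Sum.inr : Fin t → V ⊕ Fin t)) := by
    rw [Set.disjoint_left]
    rintro _ ⟨v, -, rfl⟩ ⟨u, hu⟩
    exact Sum.inr_ne_inl hu
  have hle := Set.ncard_le_ncard hsub
  rw [Set.ncard_union_eq hdisj, Set.ncard_image_of_injective _ Sum.inl_injective,
    ← Set.image_univ, Set.ncard_image_of_injective _ Sum.inr_injective, Set.ncard_univ,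
    Nat.card_fin] at hle
  have hFk : F.ncard ≤ k.choose 2 := by
    refine Nat.le_of_mul_le_mul_right ?_ (show 0 < 3 + t by omega)
    rw [mul_comm (k.choose 2), ← hk']
    exact hmul.trans hcard
  have hFcard : (Subtype.val '' F : Set (Sym2 V)).toFinset.card = F.ncard := by
    rw [← Set.ncard_eq_toFinset_card', Set.ncard_image_of_injective _ Subtype.val_injective]
  have hWcard : W.toFinset.card = W.ncard := (Set.ncard_eq_toFinset_card' W).symm
  obtain ⟨hclique, hcardW⟩ := isClique_and_card_eq_of_dense G hk
    (Subtype.val '' F : Set (Sym2 V)).toFinset W.toFinset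
    (by
      intro e he
      obtain ⟨e, -, rfl⟩ := Set.mem_toFinset.mp he
      exact e.2)
    (by
      intro e he v hv
      obtain ⟨e', he', rfl⟩ := Set.mem_toFinset.mp he
      exact Set.mem_toFinset.mpr ⟨e', he', hv⟩)
    (by omega) (by omega)
  rw [Set.coe_toFinset] at hclique
  exact ⟨W, hclique, hWcard ▸ hcardW⟩
end

section
/- Let H be a finite simple bipartite graph with bipartition (A, B), and let G' be the 2-subdivision of H, where each edge ab of H (a ∈ A, b ∈ B) is replaced by the path a — z_{ab} — z'_{ab} — b; let A' = A ∪ {z'_{ab} : ab ∈ E(H)}. Suppose S₁ ⊆ A' satisfies |N_{G'}(S₁)| < |S₁|, and v ∈ A is a vertex such that S₁ ∩ ({v} ∪ N²_{G'}(v)) is nonempty and is a proper subset of {v} ∪ N²_{G'}(v). Then the set S₂ = S₁ \ ({v} ∪ N²_{G'}(v)) also satisfies |N_{G'}(S₂)| < |S₂|. -/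
variable {V : Type*}

lemma subdiv2_adj_inl_inl (H : SimpleGraph V) (a b : V) :
    ¬ (subdiv2 H).Adj (Sum.inl a) (Sum.inl b) := by
  simp [subdiv2]

lemma subdiv2_adj_inl_inr (H : SimpleGraph V) (a : V) (d : {p : V × V // H.Adj p.1 p.2}) :
    (subdiv2 H).Adj (Sum.inl a) (Sum.inr d) ↔ d.val.1 = a := by
  simp only [subdiv2, SimpleGraph.fromRel_adj]
  constructor
  · rintro ⟨-, (⟨e, h, h'⟩ | ⟨e, e', h, -⟩) | (⟨e, h, -⟩ | ⟨e, e', -, h, -⟩)⟩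
    · cases h; cases h'; rfl
    all_goals cases h
  · rintro rfl
    exact ⟨by simp, Or.inl (Or.inl ⟨d, rfl, rfl⟩)⟩

/-- The reverse of a dart. -/
def dartSwap {H : SimpleGraph V} (d : {p : V × V // H.Adj p.1 p.2}) :
    {p : V × V // H.Adj p.1 p.2} :=
  ⟨d.val.swap, d.property.symm⟩

lemma subdiv2_adj_inr_inr (H : SimpleGraph V) (d e : {p : V × V // H.Adj p.1 p.2}) :
    (subdiv2 H).Adj (Sum.inr d) (Sum.inr e) ↔ e = dartSwap d := by
  simp only [subdiv2, SimpleGraph.fromRel_adj]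
  constructor
  · rintro ⟨-, (⟨f, h, -⟩ | ⟨f, f', h, h', h1, h2⟩) | (⟨f, h, -⟩ | ⟨f, f', h, h', h1, h2⟩)⟩
    · cases h
    · cases h; cases h'; exact Subtype.ext (Prod.ext h2.symm h1.symm)
    · cases h
    · cases h; cases h'; exact Subtype.ext (Prod.ext h1 h2)
  · rintro rfl
    refine ⟨fun h => ?_, Or.inl (Or.inr ⟨d, dartSwap d, rfl, rfl, rfl, rfl⟩)⟩
    have h' := congrArg (fun x => x.val.1) (Sum.inr.inj h)
    exact d.property.ne h'

lemma mem_nbhd2_subdiv2_inl (H : SimpleGraph V) (v : V) (x : SubdivV H) :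
    x ∈ nbhd2 (subdiv2 H) {Sum.inl v} ↔
      ∃ d : {p : V × V // H.Adj p.1 p.2}, d.val.2 = v ∧ x = Sum.inr d := by
  simp only [nbhd2, Set.mem_singleton_iff, exists_eq_left, Set.mem_ofPred_eq]
  constructor
  · intro h
    have hr : (subdiv2 H).Reachable (Sum.inl v) x := by
      by_contra hr
      rw [SimpleGraph.dist_eq_zero_of_not_reachable hr] at h
      omega
    have hne : Sum.inl v ≠ x := by
      rintro rfl
      simp at h
    obtain ⟨p, hp⟩ := hr.exists_walk_length_eq_dist
    rw [h] at hp
    obtain ⟨m, h1, h2⟩ : ∃ m, (subdiv2 H).Adj (Sum.inl v) m ∧ (subdiv2 H).Adj m x := by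
      have e1 := p.adj_getVert_succ (i := 0) (by omega)
      have e2 := p.adj_getVert_succ (i := 1) (by omega)
      rw [p.getVert_zero] at e1
      have h3 : p.getVert (1 + 1) = x := p.getVert_of_length_le (by omega)
      rw [h3] at e2
      exact ⟨_, e1, e2⟩
    rcases m with m | m
    · exact (subdiv2_adj_inl_inl H _ _ h1).elim
    rw [subdiv2_adj_inl_inr] at h1
    rcases x with x | x
    · rw [SimpleGraph.adj_comm, subdiv2_adj_inl_inr] at h2
      exact (hne (by rw [← h1, h2])).elim
    · rw [subdiv2_adj_inr_inr] at h2
      exact ⟨x, by rw [h2]; exact h1, rfl⟩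
  · rintro ⟨d, rfl, rfl⟩
    have h1 : (subdiv2 H).Adj (Sum.inl d.val.2) (Sum.inr (dartSwap d)) :=
      (subdiv2_adj_inl_inr H _ _).2 rfl
    have h2 : (subdiv2 H).Adj (Sum.inr (dartSwap d)) (Sum.inr d) :=
      (subdiv2_adj_inr_inr H _ _).2 rfl
    let p := SimpleGraph.Walk.cons h1 h2.toWalk
    have hle : (subdiv2 H).dist (Sum.inl d.val.2) (Sum.inr d) ≤ 2 := SimpleGraph.dist_le p
    have h0 : (subdiv2 H).dist (Sum.inl d.val.2) (Sum.inr d) ≠ 0 := by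
      rw [Ne, SimpleGraph.Reachable.dist_eq_zero_iff p.reachable]
      simp
    have hn1 : (subdiv2 H).dist (Sum.inl d.val.2) (Sum.inr d) ≠ 1 := by
      rw [Ne, SimpleGraph.dist_eq_one_iff_adj, subdiv2_adj_inl_inr]
      exact d.property.ne
    omega

lemma isIndepSet_subdiv2 (H : SimpleGraph V) {A B : Set V} (hdisj : A ∩ B = ∅)
    (hBi : IsIndepSet H B) :
    IsIndepSet (subdiv2 H) {x : SubdivV H | (∃ a ∈ A, x = Sum.inl a) ∨
      (∃ d : {p : V × V // H.Adj p.1 p.2}, x = Sum.inr d ∧ d.val.1 ∈ B)} := by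
  have hAB : ∀ w, w ∈ A → w ∉ B := fun w h h' => by
    have : w ∈ A ∩ B := ⟨h, h'⟩
    simp [hdisj] at this
  rintro x (⟨a, ha, rfl⟩ | ⟨d, rfl, hd⟩) y (⟨b, hb, rfl⟩ | ⟨e, rfl, he⟩) hxy
  · exact subdiv2_adj_inl_inl H _ _ hxy
  · rw [subdiv2_adj_inl_inr] at hxy
    exact hAB a ha (hxy ▸ he)
  · rw [SimpleGraph.adj_comm, subdiv2_adj_inl_inr] at hxy
    exact hAB b hb (hxy ▸ hd)
  · rw [subdiv2_adj_inr_inr] at hxy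
    subst hxy
    exact hBi hd he d.property

/-- If a set `T` injects into the neighbours lost when passing from `S` to `S \ K`, where
`T = S ∩ K`, then removing `K` preserves the violation of Hall's condition. -/
lemma ncard_nbhd_diff_lt [Finite V] (G : SimpleGraph V) {S K : Set V} (hS : IsIndepSet G S)
    (hHall : (nbhd G S).ncard < S.ncard) (f : V → V) (hf : Set.InjOn f (S ∩ K))
    (hmem : ∀ x ∈ S ∩ K, f x ∈ nbhd G S) (hnot : ∀ x ∈ S ∩ K, f x ∉ nbhd G (S \ K)) :
    (nbhd G (S \ K)).ncard < (S \ K).ncard := by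
  have hsub : nbhd G (S \ K) ∪ f '' (S ∩ K) ⊆ nbhd G S := by
    rintro x (⟨-, s, hs, hsx⟩ | ⟨y, hy, rfl⟩)
    · exact ⟨fun hx => hS hs.1 hx hsx, s, hs.1, hsx⟩
    · exact hmem y hy
  have hdis : Disjoint (nbhd G (S \ K)) (f '' (S ∩ K)) := by
    rw [Set.disjoint_right]
    rintro _ ⟨y, hy, rfl⟩
    exact hnot y hy
  have h1 := Set.ncard_le_ncard hsub (Set.toFinite _)
  rw [Set.ncard_union_eq hdis (Set.toFinite _) (Set.toFinite _), hf.ncard_image] at h1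
  have h2 := Set.ncard_inter_add_ncard_sdiff_eq_ncard S K (Set.toFinite _)
  omega

/-- correctness of the Minimize rule: in the 2-subdivision `G'` of a bipartite
graph `H` with bipartition `(A,B)`, if `S₁ ⊆ A' = A ∪ {z'_{ab}}` satisfies
`|N_{G'}(S₁)| < |S₁|` and `v ∈ A` is such that `S₁ ∩ ({v} ∪ N²_{G'}(v))` is a nonempty
proper subset of `{v} ∪ N²_{G'}(v)`, then `S₂ = S₁ \ ({v} ∪ N²_{G'}(v))` also satisfies
`|N_{G'}(S₂)| < |S₂|`. -/
theorem stmt8 [Fintype V] (H : SimpleGraph V) (A B : Set V)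
    (hunion : A ∪ B = Set.univ) (hdisj : A ∩ B = ∅)
    (hAi : IsIndepSet H A) (hBi : IsIndepSet H B)
    (S₁ : Set (SubdivV H))
    (hS₁A' : S₁ ⊆ {x : SubdivV H | (∃ a ∈ A, x = Sum.inl a) ∨
      (∃ d : {p : V × V // H.Adj p.1 p.2}, x = Sum.inr d ∧ d.val.1 ∈ B)})
    (hHall : (nbhd (subdiv2 H) S₁).ncard < S₁.ncard)
    (v : V) (hv : v ∈ A)
    (hne : (S₁ ∩ ({Sum.inl v} ∪ nbhd2 (subdiv2 H) {Sum.inl v})).Nonempty)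
    (hproper : S₁ ∩ ({Sum.inl v} ∪ nbhd2 (subdiv2 H) {Sum.inl v}) ⊂
      ({Sum.inl v} ∪ nbhd2 (subdiv2 H) {Sum.inl v})) :
    (nbhd (subdiv2 H) (S₁ \ ({Sum.inl v} ∪ nbhd2 (subdiv2 H) {Sum.inl v}))).ncard <
      (S₁ \ ({Sum.inl v} ∪ nbhd2 (subdiv2 H) {Sum.inl v})).ncard := by
  have hind : IsIndepSet (subdiv2 H) S₁ := fun x hx y hy =>
    isIndepSet_subdiv2 H hdisj hBi (hS₁A' hx) (hS₁A' hy)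
  have hout : ∀ d : {p : V × V // H.Adj p.1 p.2}, d.val.1 = v → Sum.inr d ∉ S₁ := by
    rintro d hd hdS
    rcases hS₁A' hdS with ⟨a, -, h⟩ | ⟨e, h, he⟩
    · cases h
    · cases h
      have : v ∈ A ∩ B := ⟨hv, hd ▸ he⟩
      simp [hdisj] at this
  have hK : ∀ x, x ∈ ({Sum.inl v} ∪ nbhd2 (subdiv2 H) {Sum.inl v} : Set (SubdivV H)) ↔
      x = Sum.inl v ∨ ∃ d : {p : V × V // H.Adj p.1 p.2}, d.val.2 = v ∧ x = Sum.inr d :=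
    fun x => by rw [Set.mem_union, Set.mem_singleton_iff, mem_nbhd2_subdiv2_inl]
  generalize ({Sum.inl v} ∪ nbhd2 (subdiv2 H) {Sum.inl v} : Set (SubdivV H)) = K at *
  have hlost : ∀ d : {p : V × V // H.Adj p.1 p.2}, d.val.1 = v →
      Sum.inr d ∉ nbhd (subdiv2 H) (S₁ \ K) := by
    rintro d hd ⟨-, s | s, hs, hsd⟩
    · rw [subdiv2_adj_inl_inr] at hsd
      exact hs.2 ((hK _).2 (Or.inl (by rw [← hsd, hd])))
    · rw [subdiv2_adj_inr_inr] at hsd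
      subst hsd
      exact hs.2 ((hK _).2 (Or.inr ⟨s, hd, rfl⟩))
  by_cases hvS : Sum.inl v ∈ S₁
  · obtain ⟨k, hkK, hkT⟩ := Set.exists_of_ssubset hproper
    rcases (hK k).1 hkK with rfl | ⟨e, he, rfl⟩
    · exact (hkT ⟨hvS, hkK⟩).elim
    have heS : Sum.inr e ∉ S₁ := fun h => hkT ⟨h, hkK⟩
    refine ncard_nbhd_diff_lt _ hind hHall
      (Sum.elim (fun _ => Sum.inr (dartSwap e)) fun d => Sum.inr (dartSwap d)) ?_ ?_ ?_
    · have hinj : ∀ d d' : {p : V × V // H.Adj p.1 p.2},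
          (Sum.inr (dartSwap d) : SubdivV H) = Sum.inr (dartSwap d') → d = d' := fun d d' h =>
        congrArg dartSwap (Sum.inr.inj h)
      rintro x ⟨hxS, hx⟩ y ⟨hyS, hy⟩ hxy
      rcases (hK x).1 hx with rfl | ⟨d, hd, rfl⟩ <;> rcases (hK y).1 hy with rfl | ⟨d', hd', rfl⟩
      · rfl
      · exact (heS (hinj _ _ hxy ▸ hyS)).elim
      · exact (heS (hinj _ _ hxy ▸ hxS)).elim
      · rw [hinj _ _ hxy]
    · rintro x ⟨-, hx⟩
      rcases (hK x).1 hx with rfl | ⟨d, hd, rfl⟩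
      · exact ⟨hout _ he, Sum.inl v, hvS, (subdiv2_adj_inl_inr H _ _).2 he⟩
      · exact ⟨hout _ hd, Sum.inl v, hvS, (subdiv2_adj_inl_inr H _ _).2 hd⟩
    · rintro x ⟨-, hx⟩
      rcases (hK x).1 hx with rfl | ⟨d, hd, rfl⟩
      · exact hlost _ he
      · exact hlost _ hd
  · have hT : ∀ x ∈ S₁ ∩ K, ∃ d : {p : V × V // H.Adj p.1 p.2}, d.val.2 = v ∧ x = Sum.inr d := by
      rintro x ⟨hxS, hx⟩
      exact ((hK x).1 hx).resolve_left (by rintro rfl; exact hvS hxS)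
    refine ncard_nbhd_diff_lt _ hind hHall (Sum.map id dartSwap) ?_ ?_ ?_
    · intro x hx y hy hxy
      obtain ⟨d, -, rfl⟩ := hT x hx
      obtain ⟨d', -, rfl⟩ := hT y hy
      exact congrArg (Sum.map id dartSwap) hxy
    · intro x hx
      obtain ⟨d, hd, rfl⟩ := hT x hx
      exact ⟨hout _ hd, Sum.inr d, hx.1, (subdiv2_adj_inr_inr H _ _).2 rfl⟩
    · intro x hx
      obtain ⟨d, hd, rfl⟩ := hT x hx
      exact hlost _ hd
end

section
/- Let β be a non-negative integer, let G = (V, E) be a finite simple graph with a partition (V₁, V₂) of V certifying β-separability, let S ⊆ V be a vertex cover of G, and let f : S → {0,1}. Define C₀ = {v ∈ S : f(v) = 0}, C₀¹ = {v ∈ C₀ ∩ V₂ : v has a neighbor in C₀}, C₀' = C₀ \ C₀¹, and Q(f) = C₀' minus all vertices that are an endpoint of an edge of G with both endpoints in C₀'. Then: (i) Q(f) is an independent set of G; and (ii) if S* ⊆ S is an independent set such that f(x) = 0 for all x ∈ S* and f(y) = 1 for all y ∈ A \ S*, where A = (N[S* ∩ V₁] ∩ (V₁ ∩ S)) ∪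 (N[S* ∩ V₂] ∩ S), then S* ⊆ Q(f). -/
variable {V : Type*}

/-- The closed neighborhood `N[S] = N(S) ∪ S`. -/
def clnbhd (G : SimpleGraph V) (S : Set V) : Set V :=
  nbhd G S ∪ S

/-- for a coloring `f` of the vertex cover `S`, the pruned set `Q(f)` is an
independent set, and if an independent `S* ⊆ S` receives color 0 while `A \ S*` receives
color 1 (with `A = (N[S* ∩ V₁] ∩ (V₁ ∩ S)) ∪ (N[S* ∩ V₂] ∩ S)`), then `S* ⊆ Q(f)`. -/
theorem stmt11 [Fintype V] (G : SimpleGraph V) (β : ℕ)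
    (V₁ V₂ : Set V) (hunion : V₁ ∪ V₂ = Set.univ) (hdisj : V₁ ∩ V₂ = ∅)
    (hsep₁ : ∀ v ∈ V₁, (G.neighborSet v ∩ V₁).ncard ≤ β)
    (hsep₂ : ∀ w ∈ V₂, (G.neighborSet w).ncard ≤ β)
    (S : Set V) (hvc : IsVertexCover G S)
    (f : V → Fin 2)
    (C₀ C₀' Q : Set V)
    (hC₀ : C₀ = {v ∈ S | f v = 0})
    (hC₀' : C₀' = C₀ \ {v ∈ C₀ ∩ V₂ | ∃ w ∈ C₀, G.Adj v w})
    (hQ : Q = C₀' \ {v ∈ C₀' | ∃ w ∈ C₀', G.Adj v w}) :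
    IsIndepSet G Q ∧
      ∀ Sstar : Set V, Sstar ⊆ S → IsIndepSet G Sstar →
        (∀ x ∈ Sstar, f x = 0) →
        (∀ y ∈ ((clnbhd G (Sstar ∩ V₁) ∩ (V₁ ∩ S)) ∪
          (clnbhd G (Sstar ∩ V₂) ∩ S)) \ Sstar, f y = 1) →
        Sstar ⊆ Q := by
  subst hQ hC₀' hC₀
  refine ⟨fun u hu v hv huv => hu.2 ⟨hu.1, v, hv.1, huv⟩, ?_⟩
  intro Sstar hS hind hzero hone x hx
  have hdich (v : V) : v ∈ V₁ ∨ v ∈ V₂ := by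
    have hv : v ∈ V₁ ∪ V₂ := hunion ▸ Set.mem_univ v
    exact hv
  have hxC : x ∈ {v ∈ S | f v = 0} := ⟨hS hx, hzero x hx⟩
  have mem_clnbhd {T : Set V} {w : V} (hxT : x ∈ T) (hadj : G.Adj x w) :
      w ∈ clnbhd G (Sstar ∩ T) :=
    or_iff_not_imp_right.mpr fun hw => ⟨hw, x, ⟨hx, hxT⟩, hadj⟩
  have ne_one {w : V} (hw : f w = 0) : f w ≠ 1 := by simp [hw]
  have no_adj_of_mem_V₂ (hx₂ : x ∈ V₂) {w : V} (hw : w ∈ {v ∈ S | f v = 0}) :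
      ¬ G.Adj x w := fun hadj =>
    ne_one hw.2 (hone w ⟨Or.inr ⟨mem_clnbhd hx₂ hadj, hw.1⟩, fun h => hind hx h hadj⟩)
  have hxC' : x ∈ {v ∈ S | f v = 0} \
      {v ∈ {v ∈ S | f v = 0} ∩ V₂ | ∃ w ∈ {v ∈ S | f v = 0}, G.Adj v w} :=
    ⟨hxC, fun ⟨h, w, hw, hadj⟩ => no_adj_of_mem_V₂ h.2 hw hadj⟩
  refine ⟨hxC', ?_⟩
  rintro ⟨-, w, hw, hadj⟩
  rcases hdich x with hx₁ | hx₂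
  · rcases hdich w with hw₁ | hw₂
    · exact ne_one hw.1.2
        (hone w ⟨Or.inl ⟨mem_clnbhd hx₁ hadj, hw₁, hw.1.1⟩, fun h => hind hx h hadj⟩)
    · exact hw.2 ⟨⟨hw.1, hw₂⟩, x, hxC, hadj.symm⟩
  · exact no_adj_of_mem_V₂ hx₂ hw.1 hadj
end

section
/- Let G be a finite simple graph with m edges and let G' be the 2-subdivision of G. Then for every non-negative integer t, G has a vertex cover of size at most t if and only if G' has a vertex cover of size at most t + m. -/
variable {V : Type*}

theorem isVertexCover_subdiv2_iff (G : SimpleGraph V) (S : Set (SubdivV G)) :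
    IsVertexCover (subdiv2 G) S ↔
      ∀ (u v : V) (h : G.Adj u v),
        (Sum.inl u ∈ S ∨ Sum.inr ⟨(u, v), h⟩ ∈ S) ∧
        (Sum.inr ⟨(u, v), h⟩ ∈ S ∨ Sum.inr ⟨(v, u), h.symm⟩ ∈ S) := by
  constructor
  · intro hS u v h
    constructor
    · apply hS
      rw [subdiv2, SimpleGraph.fromRel_adj]
      exact ⟨Sum.inl_ne_inr, Or.inl (Or.inl ⟨⟨(u, v), h⟩, rfl, rfl⟩)⟩
    · apply hS
      rw [subdiv2, SimpleGraph.fromRel_adj]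
      refine ⟨?_, Or.inl (Or.inr ⟨⟨(u, v), h⟩, ⟨(v, u), h.symm⟩, rfl, rfl, rfl, rfl⟩)⟩
      intro e
      simp only [Sum.inr.injEq, Subtype.mk.injEq, Prod.mk.injEq] at e
      exact h.ne e.1
  · intro hS x y hxy
    rw [subdiv2, SimpleGraph.fromRel_adj] at hxy
    obtain ⟨-, (⟨⟨⟨u, v⟩, h⟩, rfl, rfl⟩ | ⟨⟨⟨u, v⟩, h⟩, ⟨⟨v', u'⟩, h'⟩, rfl, rfl, e₁, e₂⟩) |
      (⟨⟨⟨u, v⟩, h⟩, rfl, rfl⟩ | ⟨⟨⟨u, v⟩, h⟩, ⟨⟨v', u'⟩, h'⟩, rfl, rfl, e₁, e₂⟩)⟩ := hxy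
    · exact (hS u v h).1
    · dsimp only at e₁ e₂
      subst e₁ e₂
      exact (hS _ _ h).2
    · exact (hS u v h).1.symm
    · dsimp only at e₁ e₂
      subst e₁ e₂
      exact (hS _ _ h).2.symm

/-- If every edge has an orientation satisfying `P`, then such orientations can be chosen
simultaneously. -/
theorem exists_orientation (G : SimpleGraph V) (P : {p : V × V // G.Adj p.1 p.2} → Prop)
    (hP : ∀ (u v : V) (h : G.Adj u v), P ⟨(u, v), h⟩ ∨ P ⟨(v, u), h.symm⟩) :
    ∃ f : G.edgeSet → {p : V × V // G.Adj p.1 p.2},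
      (∀ e, P (f e)) ∧ ∀ e, s((f e).val.1, (f e).val.2) = e.val := by
  have key : ∀ e : G.edgeSet, ∃ d : {p : V × V // G.Adj p.1 p.2},
      P d ∧ s(d.val.1, d.val.2) = e.val := by
    rintro ⟨e, he⟩
    induction e using Sym2.ind with
    | _ u v =>
      rcases hP u v he with h | h
      · exact ⟨_, h, rfl⟩
      · exact ⟨_, h, Sym2.eq_swap⟩
  choose f hf using key
  exact ⟨f, fun e => (hf e).1, fun e => (hf e).2⟩

theorem orientation_apply_eq_or (G : SimpleGraph V)
    (f : G.edgeSet → {p : V × V // G.Adj p.1 p.2})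
    (hf : ∀ e, s((f e).val.1, (f e).val.2) = e.val) (u v : V) (h : G.Adj u v) :
    f ⟨s(u, v), h⟩ = ⟨(u, v), h⟩ ∨ f ⟨s(u, v), h⟩ = ⟨(v, u), h.symm⟩ := by
  rcases Sym2.eq_iff.mp (hf ⟨s(u, v), h⟩) with e | e
  · exact Or.inl (Subtype.ext (Prod.ext e.1 e.2))
  · exact Or.inr (Subtype.ext (Prod.ext e.1 e.2))

theorem orientation_injective (G : SimpleGraph V)
    (f : G.edgeSet → {p : V × V // G.Adj p.1 p.2})
    (hf : ∀ e, s((f e).val.1, (f e).val.2) = e.val) : Function.Injective f := by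
  intro a b hab
  apply Subtype.ext
  rw [← hf a, ← hf b, hab]

theorem ncard_range_orientation (G : SimpleGraph V)
    (f : G.edgeSet → {p : V × V // G.Adj p.1 p.2})
    (hf : ∀ e, s((f e).val.1, (f e).val.2) = e.val) :
    (Set.range f).ncard = G.edgeSet.ncard := by
  rw [← Set.image_univ, Set.ncard_image_of_injective _ (orientation_injective G f hf),
    Set.ncard_univ, Nat.card_coe_set_eq]

theorem ncard_eq_preimage_inl_add_preimage_inr {α β : Type*} [Finite α] [Finite β]
    (S : Set (α ⊕ β)) :
    S.ncard = (Sum.inl ⁻¹' S).ncard + (Sum.inr ⁻¹' S).ncard := by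
  rw [← Set.ncard_image_of_injective (Sum.inl ⁻¹' S) (Sum.inl_injective (β := β)),
    ← Set.ncard_image_of_injective (Sum.inr ⁻¹' S) (Sum.inr_injective (α := α)),
    ← Set.ncard_union_eq, Set.image_preimage_inl_union_image_preimage_inr]
  rw [Set.disjoint_left]
  rintro _ ⟨a, -, rfl⟩ ⟨b, -, hb⟩
  exact Sum.inr_ne_inl hb

/-- `G` has a vertex cover of size at most `t` iff its 2-subdivision has a
vertex cover of size at most `t + m`, where `m` is the number of edges of `G`. -/
theorem stmt13 [Fintype V] (G : SimpleGraph V) (t : ℕ) :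
    (∃ S : Set V, IsVertexCover G S ∧ S.ncard ≤ t) ↔
      ∃ S' : Set (SubdivV G), IsVertexCover (subdiv2 G) S' ∧
        S'.ncard ≤ t + G.edgeSet.ncard := by
  constructor
  · rintro ⟨S, hS, hcard⟩
    obtain ⟨f, hfS, hf⟩ := exists_orientation G (fun d => d.val.2 ∈ S)
      fun u v h => (hS h).symm
    refine ⟨Sum.inl '' S ∪ Sum.inr '' Set.range f, ?_, ?_⟩
    · rw [isVertexCover_subdiv2_iff]
      intro u v h
      have hmem : f ⟨s(u, v), h⟩ ∈ Set.range f := Set.mem_range_self _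
      have hend := hfS ⟨s(u, v), h⟩
      rcases orientation_apply_eq_or G f hf u v h with e | e <;> rw [e] at hmem hend
      · exact ⟨Or.inr (Or.inr ⟨_, hmem, rfl⟩), Or.inl (Or.inr ⟨_, hmem, rfl⟩)⟩
      · exact ⟨Or.inl (Or.inl ⟨_, hend, rfl⟩), Or.inr (Or.inr ⟨_, hmem, rfl⟩)⟩
    · refine (Set.ncard_union_le _ _).trans ?_
      rw [Set.ncard_image_of_injective _ Sum.inl_injective,
        Set.ncard_image_of_injective _ Sum.inr_injective, ncard_range_orientation G f hf]
      exact Nat.add_le_add_right hcard _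
  · rintro ⟨S', hS', hcard⟩
    rw [isVertexCover_subdiv2_iff] at hS'
    obtain ⟨f, hfS, hf⟩ := exists_orientation G (fun d => Sum.inr d ∈ S')
      fun u v h => (hS' u v h).2
    refine ⟨Sum.inl ⁻¹' S' ∪ (fun d => d.val.1) '' (Sum.inr ⁻¹' S' \ Set.range f), ?_, ?_⟩
    · intro u v h
      by_cases hu : Sum.inl u ∈ S'
      · exact Or.inl (Or.inl hu)
      by_cases hv : Sum.inl v ∈ S'
      · exact Or.inr (Or.inl hv)
      have hd := (hS' u v h).1.resolve_left hu
      have hd' := (hS' v u h.symm).1.resolve_left hv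
      by_cases hr : (⟨(u, v), h⟩ : {p : V × V // G.Adj p.1 p.2}) ∈ Set.range f
      · refine Or.inr (Or.inr ⟨⟨(v, u), h.symm⟩, ⟨hd', ?_⟩, rfl⟩)
        rintro ⟨b, hb⟩
        obtain ⟨a, ha⟩ := hr
        have hab : a = b := by
          apply Subtype.ext
          rw [← hf a, ← hf b, ha, hb]
          exact Sym2.eq_swap
        rw [hab, hb] at ha
        exact h.ne (congrArg (fun d => d.val.2) ha)
      · exact Or.inl (Or.inr ⟨_, ⟨hd, hr⟩, rfl⟩)
    · have hsub : Set.range f ⊆ Sum.inr ⁻¹' S' := by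
        rintro _ ⟨e, rfl⟩
        exact hfS e
      have hdiff := Set.ncard_sdiff_add_ncard_of_subset hsub
      have hsplit := ncard_eq_preimage_inl_add_preimage_inr S'
      have hrange := ncard_range_orientation G f hf
      have hunion := Set.ncard_union_le (Sum.inl ⁻¹' S')
        ((fun d : {p : V × V // G.Adj p.1 p.2} => d.val.1) '' (Sum.inr ⁻¹' S' \ Set.range f))
      have himage := Set.ncard_image_le (f := fun d : {p : V × V // G.Adj p.1 p.2} => d.val.1)
        (Set.toFinite (Sum.inr ⁻¹' S' \ Set.range f))
      lia
end
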